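/- Let ρ_ABC be a density matrix on H_A ⊗ H_B ⊗ H_C satisfying I(A:C|B)_ρ = 0, and let P_AB, P_BC, P_ABC be the orthogonal projections onto the supports of ρ_AB, ρ_BC, ρ_ABC. Then the operator inequality (1 − P_AB ⊗ 1_C) + (1 − 1_A ⊗ P_BC) ≥ 1 − P_ABC holds, i.e. the difference of the two sides is positive semidefinite. -/

import Mathlib

open Matrix Kronecker BigOperators
open scoped ComplexOrder

/-- A density matrix: a positive semidefinite matrix of trace one. -/
def IsDensityMatrix {n : Type*} [Fintype n] (ρ : Matrix n n ℂ) : Prop :=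
  ρ.PosSemidef ∧ ρ.trace = 1

/-- `P` is the orthogonal projection onto the support of `ρ`, i.e. `P` is a Hermitian
idempotent whose kernel is exactly the kernel of `ρ`. -/
def IsSupportProj {n : Type*} [Fintype n] (ρ P : Matrix n n ℂ) : Prop :=
  P.IsHermitian ∧ P * P = P ∧ ∀ v : n → ℂ, ρ.mulVec v = 0 ↔ P.mulVec v = 0

/-- The von Neumann entropy `S(ρ) = -Tr(ρ log ρ)`, computed via the eigenvalues of a
Hermitian matrix (with the convention `0 log 0 = 0`). -/
noncomputable def vNEntropy {n : Type*} [Fintype n] [DecidableEq n]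
    (ρ : Matrix n n ℂ) : ℝ :=
  if h : ρ.IsHermitian then -∑ i, h.eigenvalues i * Real.log (h.eigenvalues i) else 0

/-- Reduced density matrix on `A × B` (partial trace over `C`). -/
noncomputable def margAB {A B C : Type*} [Fintype C]
    (ρ : Matrix (A × B × C) (A × B × C) ℂ) : Matrix (A × B) (A × B) ℂ :=
  Matrix.of fun p q => ∑ c : C, ρ (p.1, p.2, c) (q.1, q.2, c)

/-- Reduced density matrix on `B × C` (partial trace over `A`). -/
noncomputable def margBC {A B C : Type*} [Fintype A]
    (ρ : Matrix (A × B × C) (A × B × C) ℂ) : Matrix (B × C) (B × C) ℂ :=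
  Matrix.of fun p q => ∑ a : A, ρ (a, p) (a, q)

/-- Reduced density matrix on `B` (partial trace over `A` and `C`). -/
noncomputable def margB {A B C : Type*} [Fintype A] [Fintype C]
    (ρ : Matrix (A × B × C) (A × B × C) ℂ) : Matrix B B ℂ :=
  Matrix.of fun b b' => ∑ a : A, ∑ c : C, ρ (a, b, c) (a, b', c)

/-- Conditional mutual information `I(A:C|B) = S(AB) + S(BC) - S(B) - S(ABC)`. -/
noncomputable def CMI {A B C : Type*} [Fintype A] [DecidableEq A]
    [Fintype B] [DecidableEq B] [Fintype C] [DecidableEq C]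
    (ρ : Matrix (A × B × C) (A × B × C) ℂ) : ℝ :=
  vNEntropy (margAB ρ) + vNEntropy (margBC ρ) - vNEntropy (margB ρ) - vNEntropy ρ

/-! ### Scalar lemmas -/

/-- If `t ↦ ∑ w k / (x k + t)` is nonnegative on the positive half-line while the total weight and
the weighted logarithmic mean vanish, then it vanishes identically. -/
lemma sum_div_add_eq_zero_of_nonneg_of_pos {ι : Type*} [Fintype ι] (w x : ι → ℝ)
    (hx : ∀ k, 0 < x k) (hsum : ∑ k, w k = 0) (hlog : ∑ k, w k * Real.log (x k) = 0)
    (hnn : ∀ t : ℝ, 0 < t → 0 ≤ ∑ k, w k / (x k + t)) (t : ℝ) (ht : 0 < t) :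
    ∑ k, w k / (x k + t) = 0 := by
  set H : ℝ → ℝ := fun s => ∑ k, w k * Real.log (x k + s) with hH
  have hder : ∀ s : ℝ, 0 ≤ s → HasDerivAt H (∑ k, w k / (x k + s)) s := by
    intro s hs
    rw [hH]
    refine HasDerivAt.fun_sum fun k _ => ?_
    have h1 : HasDerivAt (fun s : ℝ => x k + s) 1 s := (hasDerivAt_id s).const_add _
    have h2 := (h1.log (by have := hx k; positivity)).const_mul (w k)
    exact h2.congr_deriv (by ring)
  have hmono : MonotoneOn H (Set.Ici 0) := by
    refine monotoneOn_of_deriv_nonneg (convex_Ici 0)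
      (fun s hs => (hder s hs).continuousAt.continuousWithinAt)
      (fun s hs => (hder s (interior_subset hs)).differentiableAt.differentiableWithinAt) ?_
    intro s hs
    rw [interior_Ici] at hs
    rw [(hder s (le_of_lt hs)).deriv]
    exact hnn s hs
  have h0 : H 0 = 0 := by simpa [hH] using hlog
  have hlim : Filter.Tendsto H Filter.atTop (nhds 0) := by
    have h1 : Filter.Tendsto (fun s : ℝ => ∑ k, w k * Real.log (x k / s + 1)) Filter.atTop
        (nhds (∑ k, w k * Real.log (0 + 1))) := by
      refine tendsto_finsetSum _ fun k _ => Filter.Tendsto.const_mul _ ?_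
      refine Filter.Tendsto.log ?_ (by norm_num)
      exact (Filter.Tendsto.const_div_atTop Filter.tendsto_id _).add_const _
    simp only [zero_add, Real.log_one, mul_zero, Finset.sum_const_zero] at h1
    refine h1.congr' ?_
    filter_upwards [Filter.eventually_gt_atTop 0] with s hs
    have : ∀ k, w k * Real.log (x k + s) = w k * Real.log (x k / s + 1) + w k * Real.log s := by
      intro k
      have hk := hx k
      rw [← mul_add, ← Real.log_mul (by positivity) (by positivity)]
      congr 2
      field_simp
    simp only [hH, this, Finset.sum_add_distrib, ← Finset.sum_mul, hsum, zero_mul, add_zero]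
  have hzero : ∀ s : ℝ, 0 ≤ s → H s = 0 := by
    intro s hs
    refine le_antisymm ?_ ?_
    · refine ge_of_tendsto hlim ?_
      filter_upwards [Filter.eventually_ge_atTop s] with u hu
      exact hmono hs (hs.trans hu) hu
    · rw [← h0]
      exact hmono (Set.self_mem_Ici) hs hs
  have hd0 : HasDerivAt H 0 t := by
    refine (hasDerivAt_const t (0 : ℝ)).congr_of_eventuallyEq ?_
    filter_upwards [eventually_gt_nhds ht] with s hs
    exact hzero s hs.le
  exact (hder t ht.le).unique hd0

lemma sum_div_add_eq_zero_of_nonneg {ι : Type*} [Fintype ι] (w x : ι → ℝ)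
    (hx : ∀ k, w k ≠ 0 → 0 < x k) (hsum : ∑ k, w k = 0)
    (hlog : ∑ k, w k * Real.log (x k) = 0)
    (hnn : ∀ t : ℝ, 0 < t → 0 ≤ ∑ k, w k / (x k + t)) (t : ℝ) (ht : 0 < t) :
    ∑ k, w k / (x k + t) = 0 := by
  classical
  set y : ι → ℝ := fun k => if w k = 0 then 1 else x k with hy
  have hyx : ∀ s k, w k / (y k + s) = w k / (x k + s) := by
    intro s k
    by_cases h : w k = 0 <;> simp [hy, h]
  have hlg : ∀ k, w k * Real.log (y k) = w k * Real.log (x k) := by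
    intro k
    by_cases h : w k = 0 <;> simp [hy, h]
  have := sum_div_add_eq_zero_of_nonneg_of_pos w y ?_ hsum (by simpa only [hlg] using hlog)
    (by simpa only [hyx] using hnn) t ht
  · simpa only [hyx] using this
  · intro k
    by_cases h : w k = 0
    · simp [hy, h]
    · simpa [hy, h] using hx k h

/-- A combination of simple poles vanishing on the positive half-line has vanishing residues. -/
lemma sum_mul_eq_zero_of_sum_div_add_eq_zero {ι : Type*} [Fintype ι] (m : ι → ℂ) (l : ι → ℝ)
    (hl : ∀ k, 0 ≤ l k) (h : ∀ t : ℝ, 0 < t → ∑ k, m k / ((l k : ℂ) + t) = 0) (f : ℝ → ℂ) :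
    ∑ k, f (l k) * m k = 0 := by
  classical
  set Λ : Finset ℝ := Finset.univ.image l with hΛ
  set p : Polynomial ℂ := ∑ k, Polynomial.C (m k) *
    ∏ a ∈ Λ.erase (l k), (Polynomial.X + Polynomial.C (a : ℂ)) with hp
  have hmem : ∀ k, l k ∈ Λ := fun k => Finset.mem_image_of_mem _ (Finset.mem_univ k)
  have hΛnn : ∀ a ∈ Λ, 0 ≤ a := by
    intro a ha
    obtain ⟨k, -, rfl⟩ := Finset.mem_image.1 ha
    exact hl k
  have hp0 : p = 0 := by
    refine Polynomial.eq_of_infinite_eval_eq p 0 ?_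
    refine Set.Infinite.mono (s := (fun t : ℝ => (t : ℂ)) '' Set.Ioi 0) ?_
      ((Set.Ioi_infinite 0).image Complex.ofReal_injective.injOn)
    rintro _ ⟨t, ht, rfl⟩
    have ht' : (0 : ℝ) < t := ht
    have key : p.eval (t : ℂ)
        = (∏ a ∈ Λ, ((t : ℂ) + (a : ℂ))) * ∑ k, m k / ((l k : ℂ) + t) := by
      rw [hp, Polynomial.eval_finsetSum, Finset.mul_sum]
      refine Finset.sum_congr rfl fun k _ => ?_
      have hne : ((l k : ℂ) + t) ≠ 0 := by
        have : l k + t ≠ 0 := by have := hl k; positivity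
        exact_mod_cast this
      rw [← Finset.mul_prod_erase Λ _ (hmem k)]
      simp only [Polynomial.eval_mul, Polynomial.eval_C, Polynomial.eval_prod,
        Polynomial.eval_add, Polynomial.eval_X]
      field_simp
      ring
    simp [key, h t ht']
  have hres : ∀ b ∈ Λ, ∑ k with l k = b, m k = 0 := by
    intro b hb
    have h1 : p.eval (-(b : ℂ)) = 0 := by simp [hp0]
    rw [hp, Polynomial.eval_finsetSum] at h1
    have h2 : ∀ k, (Polynomial.C (m k) *
        ∏ a ∈ Λ.erase (l k), (Polynomial.X + Polynomial.C (a : ℂ))).eval (-(b : ℂ))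
        = if l k = b then m k * ∏ a ∈ Λ.erase b, (-(b : ℂ) + a) else 0 := by
      intro k
      simp only [Polynomial.eval_mul, Polynomial.eval_C, Polynomial.eval_prod,
        Polynomial.eval_add, Polynomial.eval_X]
      split_ifs with hk
      · rw [hk]
      · rw [Finset.prod_eq_zero (Finset.mem_erase.2 ⟨Ne.symm hk, hb⟩) (by simp), mul_zero]
    simp only [h2] at h1
    rw [← Finset.sum_filter, ← Finset.sum_mul] at h1
    refine (mul_eq_zero.1 h1).resolve_right ?_
    refine Finset.prod_ne_zero_iff.2 fun a ha h3 => (Finset.ne_of_mem_erase ha) ?_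
    have : (a : ℂ) = b := by linear_combination h3
    exact_mod_cast this
  rw [← Finset.sum_fiberwise_of_maps_to (t := Λ) (fun k _ => hmem k)]
  refine Finset.sum_eq_zero fun b hb => ?_
  rw [Finset.sum_congr rfl (g := fun k => f b * m k), ← Finset.mul_sum, hres b hb, mul_zero]
  intro k hk
  rw [(Finset.mem_filter.1 hk).2]

/-- The complex power `x ^ z` of a nonnegative real, with `0 ^ z = 0` for every exponent. -/
noncomputable def suppPow (z : ℂ) (x : ℝ) : ℂ :=
  if x = 0 then 0 else Complex.exp (z * Real.log x)

lemma suppPow_zero_right (z : ℂ) : suppPow z 0 = 0 := by simp [suppPow]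

lemma suppPow_mul (z w : ℂ) (x : ℝ) : suppPow z x * suppPow w x = suppPow (z + w) x := by
  unfold suppPow
  split_ifs
  · simp
  · rw [← Complex.exp_add, add_mul]

lemma suppPow_one {x : ℝ} (hx : 0 ≤ x) : suppPow 1 x = x := by
  unfold suppPow
  split_ifs with h
  · simp [h]
  · rw [one_mul, ← Complex.ofReal_exp, Real.exp_log (lt_of_le_of_ne hx (Ne.symm h))]

lemma star_suppPow (z : ℂ) (x : ℝ) : star (suppPow z x) = suppPow (star z) x := by
  unfold suppPow
  split_ifs
  · simp
  · simp [← Complex.exp_conj]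

lemma suppPow_div (z : ℂ) {s r : ℝ} (hr : r ≠ 0) :
    suppPow z (s / r) = suppPow z s * suppPow (-z) r := by
  unfold suppPow
  by_cases hs : s = 0
  · simp [hs]
  · rw [if_neg (div_ne_zero hs hr), if_neg hs, if_neg hr, Real.log_div hs hr, ← Complex.exp_add]
    congr 1
    push_cast
    ring

lemma differentiable_suppPow (x : ℝ) : Differentiable ℂ fun z => suppPow z x := by
  unfold suppPow
  split_ifs <;> fun_prop

/-! ### Unitary diagonalizations and functional calculus -/

/-- A unitary diagonalization of a matrix with real eigenvalues. -/
structure UnitaryDiag {n : Type*} [Fintype n] [DecidableEq n] (X : Matrix n n ℂ) where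
  /-- The diagonalizing unitary. -/
  U : Matrix n n ℂ
  /-- The eigenvalues. -/
  e : n → ℝ
  star_mul_self : Uᴴ * U = 1
  mul_star_self : U * Uᴴ = 1
  eq : X = U * diagonal (fun i => (e i : ℂ)) * Uᴴ

namespace UnitaryDiag

variable {n : Type*} [Fintype n] [DecidableEq n] {X Y : Matrix n n ℂ}

/-- The diagonalization of a Hermitian matrix given by the spectral theorem. -/
noncomputable def ofIsHermitian (h : X.IsHermitian) : UnitaryDiag X where
  U := h.eigenvectorUnitary
  e := h.eigenvalues
  star_mul_self := by
    rw [← star_eq_conjTranspose]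
    exact Unitary.coe_star_mul_self _
  mul_star_self := by
    rw [← star_eq_conjTranspose]
    exact Unitary.coe_mul_star_self _
  eq := by
    have := h.spectral_theorem
    rw [Unitary.conjStarAlgAut_apply] at this
    exact this

/-- Functional calculus along a unitary diagonalization. -/
def fn (d : UnitaryDiag X) (f : ℝ → ℂ) : Matrix n n ℂ :=
  d.U * diagonal (fun i => f (d.e i)) * d.Uᴴ

lemma fn_mul (d : UnitaryDiag X) (f g : ℝ → ℂ) :
    d.fn f * d.fn g = d.fn (fun x => f x * g x) := by
  have : d.fn f * d.fn g = d.U * (diagonal (fun i => f (d.e i)) * (d.Uᴴ * d.U) *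
      diagonal (fun i => g (d.e i))) * d.Uᴴ := by
    simp only [fn, Matrix.mul_assoc]
  rw [this, d.star_mul_self, Matrix.mul_one, diagonal_mul_diagonal]
  rfl

lemma conjTranspose_fn (d : UnitaryDiag X) (f : ℝ → ℂ) :
    (d.fn f)ᴴ = d.fn (fun x => star (f x)) := by
  simp only [fn, conjTranspose_mul, conjTranspose_conjTranspose, diagonal_conjTranspose,
    Matrix.mul_assoc]
  rfl

lemma fn_ofReal (d : UnitaryDiag X) : d.fn (fun x => (x : ℂ)) = X := d.eq.symm

lemma fn_one (d : UnitaryDiag X) : d.fn (fun _ => 1) = 1 := by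
  simp [fn, d.mul_star_self]

lemma fn_congr (d : UnitaryDiag X) {f g : ℝ → ℂ} (h : ∀ i, f (d.e i) = g (d.e i)) :
    d.fn f = d.fn g := by
  simp only [fn, h]

lemma trace_fn (d : UnitaryDiag X) (f : ℝ → ℂ) : (d.fn f).trace = ∑ i, f (d.e i) := by
  rw [fn, trace_mul_cycle, d.star_mul_self, Matrix.one_mul, trace_diagonal]

/-- The support-restricted complex power of a diagonalized matrix. -/
noncomputable def pow (d : UnitaryDiag X) (z : ℂ) : Matrix n n ℂ := d.fn (suppPow z)

lemma supp_pow_mul (d : UnitaryDiag X) (z w : ℂ) : d.pow z * d.pow w = d.pow (z + w) := by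
  simp only [pow, fn_mul, suppPow_mul]

lemma conjTranspose_supp_pow (d : UnitaryDiag X) (z : ℂ) : (d.pow z)ᴴ = d.pow (star z) := by
  simp only [pow, conjTranspose_fn, star_suppPow]

lemma pow_one (d : UnitaryDiag X) (h : ∀ i, 0 ≤ d.e i) : d.pow 1 = X := by
  conv_rhs => rw [← d.fn_ofReal]
  exact d.fn_congr fun i => suppPow_one (h i)

lemma differentiable_pow_apply (d : UnitaryDiag X) (x y : n) :
    Differentiable ℂ fun z => d.pow z x y := by
  have : (fun z => d.pow z x y)
      = fun z => ∑ i, d.U x i * suppPow z (d.e i) * d.Uᴴ i y := by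
    ext z
    simp only [pow, fn, Matrix.mul_apply (M := d.U * _), Matrix.mul_diagonal]
  rw [this]
  refine Differentiable.fun_sum fun i _ => ?_
  exact ((differentiable_suppPow _).const_mul _).mul_const _

/-- The double operator sum `∑ k(s, r) E_s F_r`, where `E`, `F` are the spectral projections of two
diagonalized matrices. -/
def double (d : UnitaryDiag X) (d' : UnitaryDiag Y) (k : ℝ → ℝ → ℂ) : Matrix n n ℂ :=
  d.U * of (fun i j => k (d.e i) (d'.e j) * (d.Uᴴ * d'.U) i j) * d'.Uᴴ

lemma double_eq_sum (d : UnitaryDiag X) (d' : UnitaryDiag Y) (k : ℝ → ℝ → ℂ) :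
    d.double d' k = ∑ p : n × n, k (d.e p.1) (d'.e p.2) •
      ((d.Uᴴ * d'.U) p.1 p.2 • vecMulVec (fun x => d.U x p.1) (fun y => d'.Uᴴ p.2 y)) := by
  ext x y
  rw [Fintype.sum_prod_type, Finset.sum_comm, Matrix.sum_apply]
  simp only [double, Matrix.mul_apply (N := d'.Uᴴ), Matrix.mul_apply (M := d.U), of_apply,
    Finset.sum_mul, Matrix.sum_apply, Matrix.smul_apply, vecMulVec_apply, smul_eq_mul]
  refine Finset.sum_congr rfl fun j _ => Finset.sum_congr rfl fun i _ => ?_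
  ring

lemma double_mul_fn (d : UnitaryDiag X) (d' : UnitaryDiag Y) (k : ℝ → ℝ → ℂ) (g : ℝ → ℂ) :
    d.double d' k * d'.fn g = d.double d' (fun s r => k s r * g r) := by
  have : d.double d' k * d'.fn g = d.U * (of (fun i j => k (d.e i) (d'.e j) *
      (d.Uᴴ * d'.U) i j) * (d'.Uᴴ * d'.U) * diagonal (fun i => g (d'.e i))) * d'.Uᴴ := by
    simp only [fn, double, Matrix.mul_assoc]
  rw [this, d'.star_mul_self, Matrix.mul_one, double]
  congr 2
  ext i j
  rw [Matrix.mul_diagonal, of_apply, of_apply]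
  ring

lemma fn_mul_double (d : UnitaryDiag X) (d' : UnitaryDiag Y) (k : ℝ → ℝ → ℂ) (f : ℝ → ℂ) :
    d.fn f * d.double d' k = d.double d' (fun s r => f s * k s r) := by
  have : d.fn f * d.double d' k = d.U * (diagonal (fun i => f (d.e i)) * (d.Uᴴ * d.U) *
      of (fun i j => k (d.e i) (d'.e j) * (d.Uᴴ * d'.U) i j)) * d'.Uᴴ := by
    simp only [fn, double, Matrix.mul_assoc]
  rw [this, d.star_mul_self, Matrix.mul_one, double]
  congr 2
  ext i j
  rw [Matrix.diagonal_mul, of_apply, of_apply]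
  ring

lemma double_one (d : UnitaryDiag X) (d' : UnitaryDiag Y) :
    d.double d' (fun _ _ => 1) = 1 := by
  have h : (of fun i j => 1 * (d.Uᴴ * d'.U) i j) = d.Uᴴ * d'.U := by
    ext i j; simp
  rw [double, h, ← Matrix.mul_assoc, d.mul_star_self, Matrix.one_mul, d'.mul_star_self]

lemma double_mul_split (d : UnitaryDiag X) (d' : UnitaryDiag Y) (f g : ℝ → ℂ) :
    d.double d' (fun s r => f s * g r) = d.fn f * d'.fn g := by
  have := d.fn_mul_double d' (fun _ r => g r) f
  rw [← this]
  congr 1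
  have := d.double_mul_fn d' (fun _ _ => 1) g
  rw [double_one, Matrix.one_mul] at this
  rw [this]
  simp

lemma double_add (d : UnitaryDiag X) (d' : UnitaryDiag Y) (k l : ℝ → ℝ → ℂ) :
    d.double d' k + d.double d' l = d.double d' (fun s r => k s r + l s r) := by
  simp only [double_eq_sum, add_smul, Finset.sum_add_distrib]

lemma double_smul (d : UnitaryDiag X) (d' : UnitaryDiag Y) (c : ℂ) (k : ℝ → ℝ → ℂ) :
    c • d.double d' k = d.double d' (fun s r => c * k s r) := by
  simp only [double_eq_sum, Finset.smul_sum, smul_smul, mul_assoc]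

lemma double_congr (d : UnitaryDiag X) (d' : UnitaryDiag Y) {k l : ℝ → ℝ → ℂ}
    (h : ∀ i j, k (d.e i) (d'.e j) = l (d.e i) (d'.e j)) : d.double d' k = d.double d' l := by
  simp only [double, h]

lemma self_mul_fn (d : UnitaryDiag X) (f : ℝ → ℂ) : X * d.fn f = d.fn (fun x => x * f x) := by
  rw [← d.fn_mul, d.fn_ofReal]

lemma fn_mul_self (d : UnitaryDiag X) (f : ℝ → ℂ) : d.fn f * X = d.fn (fun x => f x * x) := by
  rw [← d.fn_mul, d.fn_ofReal]

lemma self_mul_double (d : UnitaryDiag X) (d' : UnitaryDiag Y) (k : ℝ → ℝ → ℂ) :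
    X * d.double d' k = d.double d' (fun s r => s * k s r) := by
  rw [← d.fn_mul_double, d.fn_ofReal]

lemma double_mul_self (d : UnitaryDiag X) (d' : UnitaryDiag Y) (k : ℝ → ℝ → ℂ) :
    d.double d' k * Y = d.double d' (fun s r => k s r * r) := by
  rw [← d.double_mul_fn, d'.fn_ofReal]

/-- The squared overlap of an eigenvector of `X` with an eigenvector of `Y`, weighted by the
eigenvalue of `Y`. -/
noncomputable def weight (d : UnitaryDiag X) (d' : UnitaryDiag Y) (p : n × n) : ℝ :=
  Complex.normSq ((d.Uᴴ * d'.U) p.1 p.2) * d'.e p.2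

lemma trace_double_mul (d : UnitaryDiag X) (d' : UnitaryDiag Y) (k : ℝ → ℝ → ℂ) :
    (d.double d' k * Y).trace
      = ∑ p : n × n, k (d.e p.1) (d'.e p.2) * (d.weight d' p : ℂ) := by
  rw [double_mul_self, double, trace_mul_cycle, trace_mul_comm,
    ← conjTranspose_conjTranspose (d'.Uᴴ * d.U), trace, Fintype.sum_prod_type]
  refine Finset.sum_congr rfl fun i _ => ?_
  rw [diag_apply, Matrix.mul_apply]
  refine Finset.sum_congr rfl fun j _ => ?_
  rw [conjTranspose_mul, conjTranspose_conjTranspose, of_apply, conjTranspose_apply, weight]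
  push_cast
  rw [Complex.normSq_eq_conj_mul_self, starRingEnd_apply]
  ring

/-- The solution of the Sylvester equation `X W + t W Y = Y`. -/
noncomputable def sylv (d : UnitaryDiag X) (d' : UnitaryDiag Y) (t : ℝ) : Matrix n n ℂ :=
  d.double d' (fun s r => (r : ℂ) / (s + t * r))

lemma sylv_eq (d : UnitaryDiag X) (d' : UnitaryDiag Y) (hd : ∀ i, 0 ≤ d.e i)
    (hd' : ∀ i, 0 ≤ d'.e i) {t : ℝ} (ht : 0 < t) :
    X * d.sylv d' t + (t : ℂ) • (d.sylv d' t * Y) = Y := by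
  have h3 : Y = d.double d' (fun s r => 1 * (r : ℂ)) := by
    rw [d.double_mul_split d' (fun _ => 1) (fun r => (r : ℂ)), d.fn_one, d'.fn_ofReal,
      Matrix.one_mul]
  rw [sylv, self_mul_double, double_mul_self, double_smul, double_add]
  conv_rhs => rw [h3]
  refine d.double_congr d' fun i j => ?_
  rcases eq_or_lt_of_le (hd' j) with h | h
  · simp [← h]
  · have hne : ((d.e i : ℂ) + t * d'.e j) ≠ 0 := by
      have : d.e i + t * d'.e j ≠ 0 := by have := hd i; positivity
      exact_mod_cast this
    conv_rhs => rw [one_mul, ← mul_div_cancel₀ (d'.e j : ℂ) hne]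
    ring

lemma mul_eq_zero_of_trace_eq_zero (d : UnitaryDiag X) (hd : ∀ i, 0 ≤ d.e i)
    {M : Matrix n n ℂ} (h : (M * X * Mᴴ).trace = 0) : M * X = 0 := by
  have hS : d.pow (1 / 2) * d.pow (1 / 2) = X := by
    rw [supp_pow_mul, add_halves, d.pow_one hd]
  have hSs : (d.pow (1 / 2))ᴴ = d.pow (1 / 2) := by
    rw [conjTranspose_supp_pow]
    simp
  have h0 : M * d.pow (1 / 2) = 0 := by
    rw [← trace_mul_conjTranspose_self_eq_zero_iff, conjTranspose_mul, hSs, ← h]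
    conv_rhs => rw [← hS]
    simp only [Matrix.mul_assoc]
  conv_lhs => rw [← hS]
  rw [← Matrix.mul_assoc, h0, Matrix.zero_mul]

lemma mul_pow_zero (d : UnitaryDiag X) : X * d.pow 0 = X := by
  refine Eq.trans ?_ d.fn_ofReal
  rw [pow, self_mul_fn]
  refine d.fn_congr fun i => ?_
  by_cases h : d.e i = 0 <;> simp [suppPow, h]

end UnitaryDiag

/-! ### Rigidity in the variational principle -/

section Rigidity

open UnitaryDiag

variable {m n : Type*} [Fintype m] [DecidableEq m] [Fintype n] [DecidableEq n]
  {X Y : Matrix n n ℂ} {X' Y' : Matrix m m ℂ}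

/-- The quadratic gap between the maximizer `W` of the variational problem for `(X, Y)` and the
image under `φ` of the maximizer `Z` for the reduced pair `(X', Y')`. -/
lemma trace_gap (φ : Matrix m m ℂ →⋆ₐ[ℂ] Matrix n n ℂ) (hX : X.IsHermitian) (hY : Y.IsHermitian)
    (hφX : ∀ Z, (X * φ Z).trace = (X' * Z).trace) (hφY : ∀ Z, (Y * φ Z).trace = (Y' * Z).trace)
    {t : ℝ} {W : Matrix n n ℂ} {Z : Matrix m m ℂ}
    (hW : X * W + (t : ℂ) • (W * Y) = Y) (hZ : X' * Z + (t : ℂ) • (Z * Y') = Y') :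
    ((φ Z - W)ᴴ * X * (φ Z - W)).trace + t * ((φ Z - W) * Y * (φ Z - W)ᴴ).trace
      = (Wᴴ * Y).trace - (Z * Y').trace := by
  have hV : φ Zᴴ = (φ Z)ᴴ := by
    rw [← star_eq_conjTranspose, map_star, star_eq_conjTranspose]
  set V := φ Z with hVdef
  have e1 : (Vᴴ * X * V).trace = (X' * Z * Zᴴ).trace := by
    rw [trace_mul_comm, ← Matrix.mul_assoc, trace_mul_comm, Matrix.mul_assoc X', ← hφX, map_mul, hV]
  have e2 : (V * Y * Vᴴ).trace = (Z * Y' * Zᴴ).trace := by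
    rw [trace_mul_comm, ← Matrix.mul_assoc, trace_mul_comm, ← hV, hVdef, ← map_mul, hφY,
      trace_mul_comm (Z * Y'), ← Matrix.mul_assoc Zᴴ, trace_mul_comm Y']
  have e3 : (Vᴴ * Y).trace = (Zᴴ * Y').trace := by
    rw [trace_mul_comm, ← hV, hφY, trace_mul_comm]
  have e4 : (V * Y).trace = (Z * Y').trace := by
    rw [trace_mul_comm, hφY, trace_mul_comm]
  have f1 : (X' * Z * Zᴴ).trace + t * (Z * Y' * Zᴴ).trace = (Zᴴ * Y').trace := by
    have := congrArg (fun M => (M * Zᴴ).trace) hZ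
    simp only [Matrix.add_mul, Matrix.smul_mul, trace_add, trace_smul, smul_eq_mul] at this
    rw [this, trace_mul_comm]
  have f2 : (Vᴴ * X * W).trace + t * (W * Y * Vᴴ).trace = (Vᴴ * Y).trace := by
    have := congrArg (fun M => (Vᴴ * M).trace) hW
    simp only [Matrix.mul_add, Matrix.mul_smul, trace_add, trace_smul, smul_eq_mul] at this
    rw [← this, Matrix.mul_assoc, trace_mul_comm (W * Y)]
  have f3 : (Wᴴ * X * W).trace + t * (W * Y * Wᴴ).trace = (Wᴴ * Y).trace := by
    have := congrArg (fun M => (Wᴴ * M).trace) hW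
    simp only [Matrix.mul_add, Matrix.mul_smul, trace_add, trace_smul, smul_eq_mul] at this
    rw [← this, Matrix.mul_assoc, trace_mul_comm (W * Y)]
  have f4 : (Wᴴ * X * V).trace + t * (V * Y * Wᴴ).trace = (V * Y).trace := by
    have := congrArg (fun M => (Mᴴ * V).trace) hW
    simp only [conjTranspose_add, conjTranspose_smul, conjTranspose_mul, hX.eq, hY.eq,
      Matrix.add_mul, Matrix.smul_mul, trace_add, trace_smul, smul_eq_mul] at this
    rw [trace_mul_comm V Y, ← this, Matrix.mul_assoc V, trace_mul_comm V]
    simp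
  have expand : ((V - W)ᴴ * X * (V - W)).trace + t * ((V - W) * Y * (V - W)ᴴ).trace
      = (Vᴴ * X * V).trace - (Vᴴ * X * W).trace - (Wᴴ * X * V).trace + (Wᴴ * X * W).trace
        + t * ((V * Y * Vᴴ).trace - (W * Y * Vᴴ).trace - (V * Y * Wᴴ).trace
          + (W * Y * Wᴴ).trace) := by
    simp only [conjTranspose_sub, Matrix.sub_mul, Matrix.mul_sub, trace_sub]
    ring
  rw [expand]
  linear_combination e1 + t * e2 + f1 - e3 - f2 + f3 - f4 - e4

namespace UnitaryDiag

lemma pos_of_weight_ne_zero (d : UnitaryDiag X) (d' : UnitaryDiag Y) (hd : ∀ i, 0 ≤ d.e i)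
    (hsupp : d.pow 0 * Y = Y) {p : n × n} (hp : d.weight d' p ≠ 0) : 0 < d.e p.1 := by
  refine lt_of_le_of_ne (hd _) fun h => hp ?_
  have h1 : d.Uᴴ * (d.pow 0 * Y) * d'.U = diagonal (fun i => suppPow 0 (d.e i)) *
      ((d.Uᴴ * d'.U) * diagonal (fun i => (d'.e i : ℂ))) := by
    have h2 : d.Uᴴ * (d.pow 0 * (d'.U * diagonal (fun i => (d'.e i : ℂ)) * d'.Uᴴ)) * d'.U
      = (d.Uᴴ * d.U) * diagonal (fun i => suppPow 0 (d.e i)) *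
      ((d.Uᴴ * d'.U) * diagonal (fun i => (d'.e i : ℂ))) * (d'.Uᴴ * d'.U) := by
      simp only [pow, fn, Matrix.mul_assoc]
    rw [← d'.eq, d.star_mul_self, d'.star_mul_self, Matrix.one_mul, Matrix.mul_one] at h2
    exact h2
  have h3 : d.Uᴴ * Y * d'.U = (d.Uᴴ * d'.U) * diagonal (fun i => (d'.e i : ℂ)) := by
    have h2 : d.Uᴴ * (d'.U * diagonal (fun i => (d'.e i : ℂ)) * d'.Uᴴ) * d'.U
      = (d.Uᴴ * d'.U) * diagonal (fun i => (d'.e i : ℂ)) * (d'.Uᴴ * d'.U) := by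
      simp only [Matrix.mul_assoc]
    rw [← d'.eq, d'.star_mul_self, Matrix.mul_one] at h2
    exact h2
  rw [hsupp, h3] at h1
  have h4 := congrFun (congrFun h1 p.1) p.2
  rw [Matrix.diagonal_mul, ← h, suppPow_zero_right, zero_mul, Matrix.mul_diagonal] at h4
  rw [weight]
  rcases mul_eq_zero.1 h4 with h5 | h5
  · simp [h5]
  · simp [Complex.ofReal_eq_zero.1 h5]

lemma trace_sylv_mul (d : UnitaryDiag X) (d' : UnitaryDiag Y) (t : ℝ) :
    (d.sylv d' t * Y).trace
      = ((∑ p, d.weight d' p / (d.e p.1 / d'.e p.2 + t) : ℝ) : ℂ) := by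
  rw [sylv, trace_double_mul]
  push_cast
  refine Finset.sum_congr rfl fun p _ => ?_
  by_cases h : d'.e p.2 = 0
  · simp [weight, h]
  · have h' : (d'.e p.2 : ℂ) ≠ 0 := by exact_mod_cast h
    have : (d.e p.1 : ℂ) / d'.e p.2 + t = (d.e p.1 + t * d'.e p.2) / d'.e p.2 := by
      field_simp
    rw [this, div_div_eq_mul_div]
    ring

lemma sylv_mul_eq_of_sum_log_eq (d : UnitaryDiag X) (d' : UnitaryDiag Y) (d₁ : UnitaryDiag X')
    (d₁' : UnitaryDiag Y') (φ : Matrix m m ℂ →⋆ₐ[ℂ] Matrix n n ℂ)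
    (hX : X.PosSemidef) (hY : Y.PosSemidef)
    (hφX : ∀ Z, (X * φ Z).trace = (X' * Z).trace) (hφY : ∀ Z, (Y * φ Z).trace = (Y' * Z).trace)
    (hd : ∀ i, 0 ≤ d.e i) (hd' : ∀ i, 0 ≤ d'.e i)
    (hd₁ : ∀ i, 0 ≤ d₁.e i) (hd₁' : ∀ i, 0 ≤ d₁'.e i)
    (hs : d.pow 0 * Y = Y) (hs₁ : d₁.pow 0 * Y' = Y')
    (hsum : ∑ p, d.weight d' p = ∑ p, d₁.weight d₁' p)
    (hlog : ∑ p, d.weight d' p * (Real.log (d.e p.1) - Real.log (d'.e p.2))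
      = ∑ p, d₁.weight d₁' p * (Real.log (d₁.e p.1) - Real.log (d₁'.e p.2)))
    {t : ℝ} (ht : 0 < t) : φ (d₁.sylv d₁' t) * Y = d.sylv d' t * Y := by
  have hgap : ∀ {t : ℝ}, 0 < t →
      ((φ (d₁.sylv d₁' t) - d.sylv d' t)ᴴ * X * (φ (d₁.sylv d₁' t) - d.sylv d' t)).trace
      + t * ((φ (d₁.sylv d₁' t) - d.sylv d' t) * Y * (φ (d₁.sylv d₁' t) - d.sylv d' t)ᴴ).trace
      = ((∑ p, d.weight d' p / (d.e p.1 / d'.e p.2 + t)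
        - ∑ p, d₁.weight d₁' p / (d₁.e p.1 / d₁'.e p.2 + t) : ℝ) : ℂ) := by
    intro t ht
    rw [trace_gap φ hX.1 hY.1 hφX hφY (d.sylv_eq d' hd hd' ht) (d₁.sylv_eq d₁' hd₁ hd₁' ht),
      trace_sylv_mul]
    have : ((d.sylv d' t)ᴴ * Y).trace = star (d.sylv d' t * Y).trace := by
      rw [← trace_conjTranspose, conjTranspose_mul, hY.1.eq, trace_mul_comm]
    rw [this, trace_sylv_mul]
    simp
  have hn1 : ∀ t, 0 ≤ ((φ (d₁.sylv d₁' t) - d.sylv d' t)ᴴ * X *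
      (φ (d₁.sylv d₁' t) - d.sylv d' t)).trace := fun t =>
    (hX.conjTranspose_mul_mul_same _).trace_nonneg
  have hn2 : ∀ t, 0 ≤ ((φ (d₁.sylv d₁' t) - d.sylv d' t) * Y *
      (φ (d₁.sylv d₁' t) - d.sylv d' t)ᴴ).trace := fun t =>
    (hY.mul_mul_conjTranspose_same _).trace_nonneg
  have wpos : ∀ p, d.weight d' p ≠ 0 → 0 < d.e p.1 ∧ 0 < d'.e p.2 := fun p hp =>
    ⟨d.pos_of_weight_ne_zero d' hd hs hp,
      lt_of_le_of_ne (hd' _) fun h => hp (by simp [weight, ← h])⟩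
  have wpos₁ : ∀ p, d₁.weight d₁' p ≠ 0 → 0 < d₁.e p.1 ∧ 0 < d₁'.e p.2 := fun p hp =>
    ⟨d₁.pos_of_weight_ne_zero d₁' hd₁ hs₁ hp,
      lt_of_le_of_ne (hd₁' _) fun h => hp (by simp [weight, ← h])⟩
  have hzero := sum_div_add_eq_zero_of_nonneg
    (Sum.elim (d.weight d') (fun p => - d₁.weight d₁' p))
    (Sum.elim (fun p => d.e p.1 / d'.e p.2) (fun p => d₁.e p.1 / d₁'.e p.2))
    (by
      rintro (p | p) hp
      · exact div_pos (wpos p hp).1 (wpos p hp).2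
      · have := wpos₁ p (by simpa using hp)
        exact div_pos this.1 this.2)
    (by simp [Fintype.sum_sum_type, hsum])
    (by
      rw [Fintype.sum_sum_type]
      simp only [Sum.elim_inl, Sum.elim_inr, neg_mul, Finset.sum_neg_distrib]
      rw [← sub_eq_add_neg, sub_eq_zero]
      refine Eq.trans (Finset.sum_congr rfl fun p _ => ?_)
        (hlog.trans (Finset.sum_congr rfl fun p _ => ?_))
      · by_cases hp : d.weight d' p = 0
        · simp [hp]
        · rw [Real.log_div (wpos p hp).1.ne' (wpos p hp).2.ne']
      · by_cases hp : d₁.weight d₁' p = 0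
        · simp [hp]
        · rw [Real.log_div (wpos₁ p hp).1.ne' (wpos₁ p hp).2.ne'])
    (by
      intro t ht
      rw [Fintype.sum_sum_type]
      simp only [Sum.elim_inl, Sum.elim_inr, neg_div, Finset.sum_neg_distrib]
      rw [← sub_eq_add_neg, ← Complex.zero_le_real, ← hgap ht]
      have ht' : (0 : ℂ) ≤ t := Complex.zero_le_real.2 ht.le
      exact add_nonneg (hn1 t) (mul_nonneg ht' (hn2 t)))
    t ht
  rw [Fintype.sum_sum_type] at hzero
  simp only [Sum.elim_inl, Sum.elim_inr, neg_div, Finset.sum_neg_distrib] at hzero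
  have h0 := hgap ht
  rw [← sub_eq_add_neg] at hzero
  rw [hzero, Complex.ofReal_zero] at h0
  have ht' : (0 : ℂ) < t := Complex.zero_lt_real.2 ht
  have h1 := ((add_eq_zero_iff_of_nonneg (hn1 t) (mul_nonneg ht'.le (hn2 t))).1 h0).2
  have h2 := d'.mul_eq_zero_of_trace_eq_zero hd' ((mul_eq_zero.1 h1).resolve_left ht'.ne')
  rwa [Matrix.sub_mul, sub_eq_zero] at h2

lemma apply_double_mul_eq (d₁ : UnitaryDiag X') (d₁' : UnitaryDiag Y')
    (ℓ : Matrix m m ℂ →ₗ[ℂ] ℂ) (k : ℝ → ℝ → ℂ) :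
    ℓ (d₁.double d₁' k) = ∑ p : m × m, k (d₁.e p.1) (d₁'.e p.2) *
      ℓ ((d₁.Uᴴ * d₁'.U) p.1 p.2 • vecMulVec (fun x => d₁.U x p.1) (fun y => d₁'.Uᴴ p.2 y)) := by
  rw [double_eq_sum, map_sum]
  simp only [map_smul, smul_eq_mul]

lemma pow_mul_pow_mul_eq (d : UnitaryDiag X) (d' : UnitaryDiag Y) (d₁ : UnitaryDiag X')
    (d₁' : UnitaryDiag Y') (φ : Matrix m m ℂ →⋆ₐ[ℂ] Matrix n n ℂ)
    (hd : ∀ i, 0 ≤ d.e i) (hd' : ∀ i, 0 ≤ d'.e i)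
    (hd₁ : ∀ i, 0 ≤ d₁.e i) (hd₁' : ∀ i, 0 ≤ d₁'.e i)
    (h : ∀ t : ℝ, 0 < t → φ (d₁.sylv d₁' t) * Y = d.sylv d' t * Y) (z : ℂ) :
    φ (d₁.pow z * d₁'.pow (-z)) * Y = d.pow z * d'.pow (-z) * Y := by
  ext x y
  set ℓ : Matrix n n ℂ →ₗ[ℂ] ℂ :=
    { toFun := fun M => (M * Y) x y
      map_add' := fun M N => by rw [Matrix.add_mul, Matrix.add_apply]
      map_smul' := fun c M => by rw [Matrix.smul_mul, Matrix.smul_apply, RingHom.id_apply] } with hℓ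
  set ℓ₁ : Matrix m m ℂ →ₗ[ℂ] ℂ := ℓ.comp φ.toAlgHom.toLinearMap with hℓ₁
  set c := fun p : n × n =>
    ℓ ((d.Uᴴ * d'.U) p.1 p.2 • vecMulVec (fun x => d.U x p.1) (fun y => d'.Uᴴ p.2 y)) with hc
  set c₁ := fun p : m × m =>
    ℓ₁ ((d₁.Uᴴ * d₁'.U) p.1 p.2 • vecMulVec (fun x => d₁.U x p.1) (fun y => d₁'.Uᴴ p.2 y)) with hc₁
  have hk : ∀ s r t : ℝ, ∀ c : ℂ, (r : ℂ) / (s + t * r) * c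
      = (if r = 0 then 0 else c) / (((s / r : ℝ) : ℂ) + t) := by
    intro s r t c
    split_ifs with hr
    · simp [hr]
    · have hr' : (r : ℂ) ≠ 0 := by exact_mod_cast hr
      have : ((s / r : ℝ) : ℂ) + t = (s + t * r) / r := by
        push_cast
        field_simp
      rw [this, div_div_eq_mul_div]
      ring
  have hf : ∀ s r : ℝ, ∀ c : ℂ, suppPow z s * suppPow (-z) r * c
      = suppPow z (s / r) * (if r = 0 then 0 else c) := by
    intro s r c
    split_ifs with hr
    · simp [hr, suppPow_zero_right]
    · rw [suppPow_div z hr]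
  have key := sum_mul_eq_zero_of_sum_div_add_eq_zero
    (Sum.elim (fun p => if d'.e p.2 = 0 then 0 else c p)
      (fun p => - if d₁'.e p.2 = 0 then 0 else c₁ p))
    (Sum.elim (fun p => d.e p.1 / d'.e p.2) (fun p => d₁.e p.1 / d₁'.e p.2))
    (by
      rintro (p | p)
      · exact div_nonneg (hd _) (hd' _)
      · exact div_nonneg (hd₁ _) (hd₁' _))
    (by
      intro t ht
      rw [Fintype.sum_sum_type]
      simp only [Sum.elim_inl, Sum.elim_inr, neg_div, Finset.sum_neg_distrib, ← hk]
      rw [hc, hc₁, ← apply_double_mul_eq d d' ℓ (fun s r => (r : ℂ) / (s + t * r)),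
        ← apply_double_mul_eq d₁ d₁' ℓ₁ (fun s r => (r : ℂ) / (s + t * r)), ← sub_eq_add_neg,
        sub_eq_zero]
      exact (congrFun (congrFun (h t ht) x) y).symm)
    (suppPow z)
  rw [Fintype.sum_sum_type] at key
  simp only [Sum.elim_inl, Sum.elim_inr, mul_neg, Finset.sum_neg_distrib, ← hf] at key
  rw [hc, hc₁, ← apply_double_mul_eq d d' ℓ (fun s r => suppPow z s * suppPow (-z) r),
    ← apply_double_mul_eq d₁ d₁' ℓ₁ (fun s r => suppPow z s * suppPow (-z) r), ← sub_eq_add_neg,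
    sub_eq_zero, double_mul_split, double_mul_split] at key
  exact key.symm

end UnitaryDiag

end Rigidity

/-! ### Support projections of a state satisfying the equality case -/

section Markov

open UnitaryDiag

lemma UnitaryDiag.map_pow_zero_mul {m n : Type*} [Fintype m] [DecidableEq m] [Fintype n]
    [DecidableEq n] {Y : Matrix n n ℂ} {Y' : Matrix m m ℂ} (d : UnitaryDiag Y)
    (d' : UnitaryDiag Y') (hd : ∀ i, 0 ≤ d.e i) (φ : Matrix m m ℂ →⋆ₐ[ℂ] Matrix n n ℂ)
    (h : ∀ Z, (Y * φ Z).trace = (Y' * Z).trace) : φ (d'.pow 0) * Y = Y := by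
  have hP : (φ (d'.pow 0))ᴴ = φ (d'.pow 0) := by
    rw [← star_eq_conjTranspose, ← map_star, star_eq_conjTranspose, conjTranspose_supp_pow, star_zero]
  have hPP : φ (d'.pow 0) * φ (d'.pow 0) = φ (d'.pow 0) := by
    rw [← map_mul, supp_pow_mul, add_zero]
  have h0 : ((1 - φ (d'.pow 0)) * Y * (1 - φ (d'.pow 0))ᴴ).trace = 0 := by
    rw [trace_mul_comm, ← Matrix.mul_assoc, conjTranspose_sub, conjTranspose_one, hP]
    have : (1 - φ (d'.pow 0)) * (1 - φ (d'.pow 0)) = φ (1 - d'.pow 0) := by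
      rw [map_sub, map_one, Matrix.sub_mul, Matrix.one_mul, Matrix.mul_sub, Matrix.mul_one, hPP,
        sub_self, sub_zero]
    rw [this, trace_mul_comm, h, Matrix.mul_sub, mul_pow_zero]
    simp
  have := d.mul_eq_zero_of_trace_eq_zero hd h0
  rw [Matrix.sub_mul, Matrix.one_mul, sub_eq_zero] at this
  exact this.symm

lemma differentiable_map_apply {m n : Type*} [Fintype m] [DecidableEq m] [Fintype n]
    [DecidableEq n] (φ : Matrix m m ℂ →⋆ₐ[ℂ] Matrix n n ℂ) {F : ℂ → Matrix m m ℂ}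
    (hF : ∀ x y, Differentiable ℂ fun z => F z x y) (x y : n) :
    Differentiable ℂ fun z => φ (F z) x y := by
  have : (fun z => φ (F z) x y)
      = fun z => ∑ i, ∑ j, F z i j * φ (Matrix.single i j 1) x y := by
    ext z
    conv_lhs => rw [matrix_eq_sum_single (F z)]
    simp only [map_sum, Matrix.sum_apply]
    refine Finset.sum_congr rfl fun i _ => Finset.sum_congr rfl fun j _ => ?_
    have : Matrix.single i j (F z i j) = F z i j • Matrix.single i j (1 : ℂ) := by
      rw [Matrix.smul_single, smul_eq_mul, mul_one]
    rw [this, map_smul, Matrix.smul_apply, smul_eq_mul]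
  rw [this]
  exact Differentiable.fun_sum fun i _ => Differentiable.fun_sum fun j _ => (hF i j).mul_const _

lemma differentiable_mul_apply {n : Type*} [Fintype n] {F G : ℂ → Matrix n n ℂ}
    (hF : ∀ x y, Differentiable ℂ fun z => F z x y)
    (hG : ∀ x y, Differentiable ℂ fun z => G z x y) (x y : n) :
    Differentiable ℂ fun z => (F z * G z) x y := by
  simp only [Matrix.mul_apply]
  exact Differentiable.fun_sum fun i _ => (hF x i).mul (hG i y)

/-- Two entire functions that agree on the line `Re z = 1 / 2` are equal. -/
lemma eq_of_eqOn_critical_line {f g : ℂ → ℂ} (hf : Differentiable ℂ f) (hg : Differentiable ℂ g)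
    (h : ∀ z : ℂ, z.re = 1 / 2 → f z = g z) : f = g := by
  refine AnalyticOnNhd.eq_of_frequently_eq (z₀ := (1 / 2 : ℂ))
    (fun z _ => hf.analyticAt z) (fun z _ => hg.analyticAt z) ?_
  have hlim : Filter.Tendsto (fun s : ℝ => (1 / 2 : ℂ) + s * Complex.I) (nhdsWithin 0 {0}ᶜ)
      (nhdsWithin (1 / 2 : ℂ) {(1 / 2 : ℂ)}ᶜ) := by
    refine tendsto_nhdsWithin_iff.2 ⟨?_, ?_⟩
    · have : Continuous fun s : ℝ => (1 / 2 : ℂ) + s * Complex.I := by fun_prop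
      have h := (this.tendsto 0).mono_left (nhdsWithin_le_nhds (s := {0}ᶜ))
      simpa using h
    · filter_upwards [self_mem_nhdsWithin] with s hs
      simpa using hs
  refine hlim.frequently (Filter.Eventually.frequently (Filter.Eventually.of_forall fun s => ?_))
  exact h _ (by simp)

lemma mul_eq_self_of_trace_eq {n : Type*} [Fintype n] {T R : Matrix n n ℂ} (hR : Rᴴ = R)
    (hRR : R * R = R) (h : (T * Tᴴ).trace = (T * R * (T * R)ᴴ).trace) : T * R = T := by
  have e1 : T * R * (R * Tᴴ) = T * R * Tᴴ := by
    rw [← Matrix.mul_assoc, Matrix.mul_assoc T, hRR]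
  have e2 : (T - T * R) * (T - T * R)ᴴ = T * Tᴴ - T * R * (T * R)ᴴ := by
    rw [conjTranspose_sub, conjTranspose_mul, hR, Matrix.sub_mul, Matrix.mul_sub,
      Matrix.mul_sub, e1, ← Matrix.mul_assoc]
    abel
  refine (sub_eq_zero.1 (trace_mul_conjTranspose_self_eq_zero_iff.1 ?_)).symm
  rw [e2, trace_sub, h, sub_self]

/-- If the modular identity coming from equality in strong subadditivity holds, then the support
projections satisfy `P_AB P_BC = P_ABC`. -/
lemma support_mul_support_eq {m n p q : Type*} [Fintype m] [DecidableEq m] [Fintype n]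
    [DecidableEq n] [Fintype p] [DecidableEq p] [Fintype q] [DecidableEq q]
    {ρ : Matrix n n ℂ} {ρAB : Matrix m m ℂ} {ρBC : Matrix p p ℂ} {ρB : Matrix q q ℂ}
    (d : UnitaryDiag ρ) (dAB : UnitaryDiag ρAB) (dBC : UnitaryDiag ρBC) (dB : UnitaryDiag ρB)
    (hd : ∀ i, 0 ≤ d.e i) (hdAB : ∀ i, 0 ≤ dAB.e i) (hdBC : ∀ i, 0 ≤ dBC.e i)
    (hdB : ∀ i, 0 ≤ dB.e i)
    (α : Matrix m m ℂ →⋆ₐ[ℂ] Matrix n n ℂ) (β : Matrix p p ℂ →⋆ₐ[ℂ] Matrix n n ℂ)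
    (κ : Matrix q q ℂ →⋆ₐ[ℂ] Matrix m m ℂ)
    (hα : ∀ Z, (ρ * α Z).trace = (ρAB * Z).trace)
    (hκ : ∀ Z, (ρAB * κ Z).trace = (ρB * Z).trace)
    (hβα : ∀ Z, (β ρBC * α Z).trace = (κ ρB * Z).trace)
    (h : ∀ z : ℂ, α (κ (dB.pow z) * dAB.pow (-z)) * ρ = β (dBC.pow z) * d.pow (-z) * ρ) :
    α (dAB.pow 0) * β (dBC.pow 0) = d.pow 0 := by
  have hκAB : ∀ z, κ (dB.pow 0) * dAB.pow z = dAB.pow z := by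
    intro z
    have h1 : dAB.pow z = ρAB * dAB.pow (z - 1) := by
      conv_rhs => enter [1]; rw [← dAB.pow_one hdAB]
      rw [supp_pow_mul, add_sub_cancel]
    rw [h1, ← Matrix.mul_assoc, dAB.map_pow_zero_mul dB hdAB κ hκ]
  have hρpow : ∀ z, ρ * d.pow (z - 1) = d.pow z := by
    intro z
    conv_lhs => enter [1]; rw [← d.pow_one hd]
    rw [supp_pow_mul, add_sub_cancel]
  have hαd : ∀ z, α (dAB.pow 0) * d.pow z = d.pow z := by
    intro z
    rw [← hρpow z, ← Matrix.mul_assoc, d.map_pow_zero_mul dAB hd α hα]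
  have hβR : ∀ z, β (dBC.pow z) * d.pow 0 = α (κ (dB.pow z) * dAB.pow (-z)) * d.pow z := by
    intro z
    have := congrArg (fun M => M * d.pow (z - 1)) (h z)
    simp only [Matrix.mul_assoc, hρpow, supp_pow_mul, neg_add_cancel] at this
    exact this.symm
  set T : ℂ → Matrix n n ℂ := fun z => α (dAB.pow z * κ (dB.pow (-z))) * β (dBC.pow z) with hT
  have hTR : ∀ z, T z * d.pow 0 = d.pow z := by
    intro z
    rw [hT]
    simp only
    rw [Matrix.mul_assoc, hβR, ← Matrix.mul_assoc, ← map_mul]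
    have : dAB.pow z * κ (dB.pow (-z)) * (κ (dB.pow z) * dAB.pow (-z)) = dAB.pow 0 := by
      rw [Matrix.mul_assoc, ← Matrix.mul_assoc (κ _), ← map_mul, supp_pow_mul, neg_add_cancel, hκAB,
        supp_pow_mul, add_neg_cancel]
    rw [this, hαd]
  have hαstar : ∀ M, (α M)ᴴ = α Mᴴ := fun M => (map_star α M).symm
  have hβstar : ∀ M, (β M)ᴴ = β Mᴴ := fun M => (map_star β M).symm
  have hκstar : ∀ M, (κ M)ᴴ = κ Mᴴ := fun M => (map_star κ M).symm
  have htr : ρ.trace = ρAB.trace := by simpa using hα 1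
  have hline : ∀ z : ℂ, z.re = 1 / 2 → T z = d.pow z := by
    intro z hz
    have hzz : z + star z = 1 := by
      apply Complex.ext
      · simp [hz]; norm_num
      · simp
    have hTT : (T z * (T z)ᴴ).trace = ρ.trace := by
      set K := dAB.pow z * κ (dB.pow (-z)) with hK
      have e1 : T z * (T z)ᴴ = α K * (β ρBC * α Kᴴ) := by
        rw [hT]
        simp only
        rw [conjTranspose_mul, hαstar, hβstar, conjTranspose_supp_pow, Matrix.mul_assoc,
          ← Matrix.mul_assoc (β _), ← map_mul β, supp_pow_mul, hzz, dBC.pow_one hdBC]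
      have e2 : Kᴴ * K = κ (dB.pow (-star z)) * ρAB * κ (dB.pow (-z)) := by
        rw [hK, conjTranspose_mul, hκstar, conjTranspose_supp_pow, conjTranspose_supp_pow, star_neg,
          Matrix.mul_assoc, ← Matrix.mul_assoc (dAB.pow _), supp_pow_mul, add_comm, hzz,
          dAB.pow_one hdAB, Matrix.mul_assoc]
      have e3 : dB.pow (-z) * ρB * dB.pow (-star z) = dB.pow 0 := by
        conv_lhs => enter [1, 2]; rw [← dB.pow_one hdB]
        rw [supp_pow_mul, supp_pow_mul, ← hzz]
        congr 1
        ring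
      rw [e1, trace_mul_comm, Matrix.mul_assoc, ← map_mul, hβα, e2, ← Matrix.mul_assoc,
        trace_mul_comm, ← Matrix.mul_assoc, ← Matrix.mul_assoc, ← map_mul, ← map_mul, e3,
        dAB.map_pow_zero_mul dB hdAB κ hκ, htr]
    have hR : (d.pow 0)ᴴ = d.pow 0 := by rw [conjTranspose_supp_pow, star_zero]
    have hRR : d.pow 0 * d.pow 0 = d.pow 0 := by rw [supp_pow_mul, add_zero]
    have h0 := mul_eq_self_of_trace_eq hR hRR (T := T z) (by
      rw [hTT, hTR, conjTranspose_supp_pow, supp_pow_mul, hzz, d.pow_one hd])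
    rw [← h0, hTR]
  have hT0 : T 0 = d.pow 0 := by
    ext x y
    have hneg : ∀ i j, Differentiable ℂ fun z => dB.pow (-z) i j := fun i j =>
      (dB.differentiable_pow_apply i j).comp differentiable_neg
    refine congrFun (eq_of_eqOn_critical_line (f := fun z => T z x y) (g := fun z => d.pow z x y)
      ?_ (d.differentiable_pow_apply x y) fun z hz => by rw [hline z hz]) 0
    exact differentiable_mul_apply
      (differentiable_map_apply α (differentiable_mul_apply dAB.differentiable_pow_apply
        (differentiable_map_apply κ hneg)))
      (differentiable_map_apply β dBC.differentiable_pow_apply) x y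
  have hABκ : dAB.pow 0 * κ (dB.pow 0) = dAB.pow 0 := by
    have := congrArg conjTranspose (hκAB 0)
    rwa [conjTranspose_mul, hκstar, conjTranspose_supp_pow, conjTranspose_supp_pow, star_zero] at this
  rw [← hT0, hT]
  simp only [neg_zero, hABκ]

/-- The embedding `Y ↦ 1 ⊗ Y`. -/
def oneKronHom (A n : Type*) [Fintype A] [DecidableEq A] [Fintype n] [DecidableEq n] :
    Matrix n n ℂ →⋆ₐ[ℂ] Matrix (A × n) (A × n) ℂ where
  toFun Y := (1 : Matrix A A ℂ) ⊗ₖ Y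
  map_one' := one_kronecker_one
  map_mul' X Y := by rw [← mul_kronecker_mul, Matrix.one_mul]
  map_zero' := kronecker_zero _
  map_add' X Y := kronecker_add _ _ _
  commutes' c := by
    simp only [Algebra.algebraMap_eq_smul_one, kronecker_smul, one_kronecker_one]
  map_star' X := by
    simp only [star_eq_conjTranspose, conjTranspose_kronecker, conjTranspose_one]

/-- The embedding `Y ↦ Y ⊗ 1` of operators on `A × B` into operators on `A × B × C`. -/
def kronOneHom (A B C : Type*) [Fintype A] [DecidableEq A] [Fintype B] [DecidableEq B]
    [Fintype C] [DecidableEq C] :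
    Matrix (A × B) (A × B) ℂ →⋆ₐ[ℂ] Matrix (A × B × C) (A × B × C) ℂ where
  toFun Y := Matrix.reindex (Equiv.prodAssoc A B C) (Equiv.prodAssoc A B C)
    (Y ⊗ₖ (1 : Matrix C C ℂ))
  map_one' := by simp
  map_mul' X Y := by
    simp only [reindex_apply, submatrix_mul_equiv, ← mul_kronecker_mul, Matrix.one_mul]
  map_zero' := by simp
  map_add' X Y := by simp [add_kronecker, submatrix_add]
  commutes' c := by
    simp [Algebra.algebraMap_eq_smul_one, smul_kronecker, submatrix_smul]
  map_star' X := by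
    simp [star_eq_conjTranspose, conjTranspose_submatrix, conjTranspose_kronecker]

/-- The diagonalization of `1 ⊗ X` induced by one of `X`. -/
def UnitaryDiag.oneKron (A : Type*) [Fintype A] [DecidableEq A] {n : Type*} [Fintype n]
    [DecidableEq n] {X : Matrix n n ℂ} (d : UnitaryDiag X) :
    UnitaryDiag (oneKronHom A n X) where
  U := oneKronHom A n d.U
  e p := d.e p.2
  star_mul_self := by
    rw [← star_eq_conjTranspose, ← map_star, ← map_mul, star_eq_conjTranspose, d.star_mul_self,
      map_one]
  mul_star_self := by
    rw [← star_eq_conjTranspose, ← map_star, ← map_mul, star_eq_conjTranspose, d.mul_star_self,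
      map_one]
  eq := by
    have : diagonal (fun p : A × n => (d.e p.2 : ℂ))
        = oneKronHom A n (diagonal fun i => (d.e i : ℂ)) := by
      simp [oneKronHom, ← diagonal_one, diagonal_kronecker_diagonal]
    rw [this, ← star_eq_conjTranspose, ← map_star, ← map_mul, ← map_mul, star_eq_conjTranspose,
      ← d.eq]

lemma UnitaryDiag.oneKron_fn (A : Type*) [Fintype A] [DecidableEq A] {n : Type*} [Fintype n]
    [DecidableEq n] {X : Matrix n n ℂ} (d : UnitaryDiag X) (f : ℝ → ℂ) :
    (d.oneKron A).fn f = oneKronHom A n (d.fn f) := by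
  have : diagonal (fun p : A × n => f (d.e p.2))
      = oneKronHom A n (diagonal fun i => f (d.e i)) := by
    simp [oneKronHom, ← diagonal_one, diagonal_kronecker_diagonal]
  rw [fn, fn, map_mul, map_mul, ← this, ← star_eq_conjTranspose d.U, map_star]
  rfl

end Markov

/-! ### Entropy sums along diagonalizations -/

namespace UnitaryDiag

variable {n : Type*} [Fintype n] [DecidableEq n] {X Y : Matrix n n ℂ}

lemma sum_weight (d : UnitaryDiag X) (d' : UnitaryDiag Y) :
    ((∑ p, d.weight d' p : ℝ) : ℂ) = Y.trace := by
  have := d.trace_double_mul d' (fun _ _ => 1)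
  rw [double_one, Matrix.one_mul] at this
  rw [this]
  push_cast
  simp only [one_mul]

lemma sum_weight_mul_log_sub (d : UnitaryDiag X) (d' : UnitaryDiag Y) :
    ((∑ p, d.weight d' p * (Real.log (d.e p.1) - Real.log (d'.e p.2)) : ℝ) : ℂ)
      = (Y * d.fn fun x => (Real.log x : ℂ)).trace
        - ((∑ i, d'.e i * Real.log (d'.e i) : ℝ) : ℂ) := by
  have h1 := d.trace_double_mul d' (fun s _ => (Real.log s : ℂ) * 1)
  have h2 := d.trace_double_mul d' (fun _ r => 1 * (Real.log r : ℂ))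
  rw [d.double_mul_split d' (fun s => (Real.log s : ℂ)) (fun _ => 1), d'.fn_one,
    Matrix.mul_one] at h1
  rw [d.double_mul_split d' (fun _ => 1) (fun r => (Real.log r : ℂ)), d.fn_one,
    Matrix.one_mul, fn_mul_self, trace_fn] at h2
  have h3 : ((∑ i, d'.e i * Real.log (d'.e i) : ℝ) : ℂ)
      = ∑ i, (Real.log (d'.e i) : ℂ) * (d'.e i : ℂ) := by
    push_cast
    exact Finset.sum_congr rfl fun i _ => mul_comm _ _
  rw [trace_mul_comm, h1, h3, h2, ← Finset.sum_sub_distrib]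
  push_cast
  refine Finset.sum_congr rfl fun p _ => ?_
  ring

lemma trace_mul_fn_log (d : UnitaryDiag X) :
    (X * d.fn fun x => (Real.log x : ℂ)).trace
      = ((∑ i, d.e i * Real.log (d.e i) : ℝ) : ℂ) := by
  rw [self_mul_fn, trace_fn]
  push_cast
  rfl

lemma eq_supp_pow_zero {P : Matrix n n ℂ} (d : UnitaryDiag X) (h : IsSupportProj X P) :
    P = d.pow 0 := by
  obtain ⟨hP, hPP, hker⟩ := h
  have hQ : (d.pow 0)ᴴ = d.pow 0 := by rw [conjTranspose_supp_pow, star_zero]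
  have hinv : d.fn (fun x => ((x⁻¹ : ℝ) : ℂ)) * X = d.pow 0 := by
    rw [fn_mul_self]
    refine d.fn_congr fun i => ?_
    by_cases hi : d.e i = 0 <;> simp [suppPow, hi]
  have h1 : P * (1 - d.pow 0) = 0 := by
    refine Matrix.ext_of_mulVec_single fun i => ?_
    rw [zero_mulVec, ← mulVec_mulVec, ← hker, mulVec_mulVec, Matrix.mul_sub, mul_pow_zero, Matrix.mul_one, sub_self,
      zero_mulVec]
  have h2 : X * (1 - P) = 0 := by
    refine Matrix.ext_of_mulVec_single fun i => ?_
    rw [zero_mulVec, ← mulVec_mulVec, hker, mulVec_mulVec, Matrix.mul_sub, hPP,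
      Matrix.mul_one, sub_self, zero_mulVec]
  have h3 : d.pow 0 * (1 - P) = 0 := by
    rw [← hinv, Matrix.mul_assoc, h2, Matrix.mul_zero]
  rw [Matrix.mul_sub, Matrix.mul_one, sub_eq_zero] at h1 h3
  have h4 := congrArg conjTranspose h3
  rw [conjTranspose_mul, hQ, hP.eq] at h4
  exact h1.trans h4.symm

end UnitaryDiag

lemma vNEntropy_eq {n : Type*} [Fintype n] [DecidableEq n] {X : Matrix n n ℂ}
    (h : X.IsHermitian) :
    vNEntropy X = -∑ i, (UnitaryDiag.ofIsHermitian h).e i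
      * Real.log ((UnitaryDiag.ofIsHermitian h).e i) :=
  dif_pos h

/-! ### Partial traces -/

lemma posSemidef_margAB {A B C : Type*} [Fintype C]
    {ρ : Matrix (A × B × C) (A × B × C) ℂ} (h : ρ.PosSemidef) : (margAB ρ).PosSemidef := by
  have : margAB ρ = ∑ c : C, ρ.submatrix (fun p : A × B => (p.1, p.2, c))
      fun p => (p.1, p.2, c) := by
    ext p q
    simp [margAB, Matrix.sum_apply]
  rw [this]
  exact posSemidef_sum _ fun c _ => h.submatrix _

lemma posSemidef_partialTrace {A n : Type*} [Fintype A] {σ : Matrix (A × n) (A × n) ℂ}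
    (h : σ.PosSemidef) : (of fun p q => ∑ a : A, σ (a, p) (a, q) : Matrix n n ℂ).PosSemidef := by
  have : (of fun p q => ∑ a : A, σ (a, p) (a, q) : Matrix n n ℂ)
      = ∑ a : A, σ.submatrix (fun p : n => (a, p)) fun p => (a, p) := by
    ext p q
    simp [Matrix.sum_apply]
  rw [this]
  exact posSemidef_sum _ fun c _ => h.submatrix _

lemma posSemidef_margBC {A B C : Type*} [Fintype A]
    {ρ : Matrix (A × B × C) (A × B × C) ℂ} (h : ρ.PosSemidef) : (margBC ρ).PosSemidef :=
  posSemidef_partialTrace h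

lemma posSemidef_margB {A B C : Type*} [Fintype A] [Fintype C]
    {ρ : Matrix (A × B × C) (A × B × C) ℂ} (h : ρ.PosSemidef) : (margB ρ).PosSemidef :=
  posSemidef_partialTrace (posSemidef_margAB h)

section Marginals

variable {A B C : Type*} [Fintype A] [DecidableEq A] [Fintype B] [DecidableEq B]
  [Fintype C] [DecidableEq C]

lemma oneKronHom_apply {n : Type*} [Fintype n] [DecidableEq n] (Y : Matrix n n ℂ)
    (p q : A × n) : oneKronHom A n Y p q = if p.1 = q.1 then Y p.2 q.2 else 0 := by
  change ((1 : Matrix A A ℂ) ⊗ₖ Y) p q = _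
  rw [kronecker_apply, one_apply]
  split_ifs <;> simp

lemma kronOneHom_apply (Y : Matrix (A × B) (A × B) ℂ) (p q : A × B × C) :
    kronOneHom A B C Y p q
      = if p.2.2 = q.2.2 then Y (p.1, p.2.1) (q.1, q.2.1) else 0 := by
  change (Y ⊗ₖ (1 : Matrix C C ℂ)) ((p.1, p.2.1), p.2.2) ((q.1, q.2.1), q.2.2) = _
  rw [kronecker_apply, one_apply]
  split_ifs <;> simp

lemma trace_mul_kronOneHom (ρ : Matrix (A × B × C) (A × B × C) ℂ)
    (Y : Matrix (A × B) (A × B) ℂ) :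
    (ρ * kronOneHom A B C Y).trace = (margAB ρ * Y).trace := by
  simp only [trace, diag_apply, Matrix.mul_apply, kronOneHom_apply, margAB, of_apply,
    Fintype.sum_prod_type, mul_ite, mul_zero, Finset.sum_ite_eq', Finset.mem_univ, if_true,
    Finset.sum_mul]
  refine Finset.sum_congr rfl fun a _ => Finset.sum_congr rfl fun b _ => ?_
  rw [Finset.sum_comm]
  refine Finset.sum_congr rfl fun a' _ => ?_
  rw [Finset.sum_comm]

lemma trace_mul_oneKronHom {n : Type*} [Fintype n] [DecidableEq n]
    (σ : Matrix (A × n) (A × n) ℂ) (Y : Matrix n n ℂ) :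
    (σ * oneKronHom A n Y).trace
      = ((of fun p q => ∑ a : A, σ (a, p) (a, q) : Matrix n n ℂ) * Y).trace := by
  simp only [trace, diag_apply, Matrix.mul_apply, oneKronHom_apply, of_apply,
    Fintype.sum_prod_type, mul_ite, mul_zero, Finset.sum_mul]
  rw [Finset.sum_comm]
  refine Finset.sum_congr rfl fun x _ => ?_
  rw [Finset.sum_comm (s := (Finset.univ : Finset n))]
  refine Finset.sum_congr rfl fun a _ => ?_
  rw [Finset.sum_comm]
  refine Finset.sum_congr rfl fun y _ => ?_
  simp

lemma trace_mul_oneKronHom_eq_margBC (ρ : Matrix (A × B × C) (A × B × C) ℂ)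
    (Y : Matrix (B × C) (B × C) ℂ) :
    (ρ * oneKronHom A (B × C) Y).trace = (margBC ρ * Y).trace :=
  trace_mul_oneKronHom ρ Y

lemma trace_margAB_mul_oneKronHom {A B C : Type*} [Fintype A] [DecidableEq A] [Fintype B]
    [DecidableEq B] [Fintype C] (ρ : Matrix (A × B × C) (A × B × C) ℂ) (Y : Matrix B B ℂ) :
    (margAB ρ * oneKronHom A B Y).trace = (margB ρ * Y).trace :=
  trace_mul_oneKronHom _ Y

lemma margAB_oneKronHom_margBC (ρ : Matrix (A × B × C) (A × B × C) ℂ) :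
    margAB (oneKronHom A (B × C) (margBC ρ)) = oneKronHom A B (margB ρ) := by
  ext p q
  rw [oneKronHom_apply]
  simp only [margAB, margBC, margB, of_apply, oneKronHom_apply]
  split_ifs
  · rw [Finset.sum_comm]
  · simp

/-- Equality in strong subadditivity forces `P_AB P_BC = P_ABC`. -/
lemma support_mul_support_eq_of_CMI_eq_zero {ρ : Matrix (A × B × C) (A × B × C) ℂ}
    (hρ : ρ.PosSemidef) (hMarkov : CMI ρ = 0)
    {PAB : Matrix (A × B) (A × B) ℂ} (hPAB : IsSupportProj (margAB ρ) PAB)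
    {PBC : Matrix (B × C) (B × C) ℂ} (hPBC : IsSupportProj (margBC ρ) PBC)
    {PABC : Matrix (A × B × C) (A × B × C) ℂ} (hPABC : IsSupportProj ρ PABC) :
    kronOneHom A B C PAB * oneKronHom A (B × C) PBC = PABC := by
  have hAB := posSemidef_margAB hρ
  have hBC := posSemidef_margBC hρ
  have hB := posSemidef_margB hρ
  rw [CMI, vNEntropy_eq hAB.1, vNEntropy_eq hBC.1, vNEntropy_eq hB.1, vNEntropy_eq hρ.1]
    at hMarkov
  have hd := hρ.eigenvalues_nonneg
  have hdAB := hAB.eigenvalues_nonneg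
  have hdBC := hBC.eigenvalues_nonneg
  have hdB := hB.eigenvalues_nonneg
  change ∀ i, 0 ≤ (UnitaryDiag.ofIsHermitian hρ.1).e i at hd
  change ∀ i, 0 ≤ (UnitaryDiag.ofIsHermitian hAB.1).e i at hdAB
  change ∀ i, 0 ≤ (UnitaryDiag.ofIsHermitian hBC.1).e i at hdBC
  change ∀ i, 0 ≤ (UnitaryDiag.ofIsHermitian hB.1).e i at hdB
  generalize UnitaryDiag.ofIsHermitian hρ.1 = d at *
  generalize UnitaryDiag.ofIsHermitian hAB.1 = dAB at *
  generalize UnitaryDiag.ofIsHermitian hBC.1 = dBC at *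
  generalize UnitaryDiag.ofIsHermitian hB.1 = dB at *
  have hα := trace_mul_kronOneHom ρ
  have hβ := trace_mul_oneKronHom_eq_margBC ρ
  have hκ := trace_margAB_mul_oneKronHom ρ
  have hβα : ∀ Z, (oneKronHom A (B × C) (margBC ρ) * kronOneHom A B C Z).trace
      = (oneKronHom A B (margB ρ) * Z).trace := fun Z => by
    rw [trace_mul_kronOneHom, margAB_oneKronHom_margBC]
  have hβpow : ∀ z, (dBC.oneKron A).pow z = oneKronHom A (B × C) (dBC.pow z) :=
    fun z => dBC.oneKron_fn A _
  have hκpow : ∀ z, (dB.oneKron A).pow z = oneKronHom A B (dB.pow z) :=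
    fun z => dB.oneKron_fn A _
  have hX : (oneKronHom A (B × C) (margBC ρ)).PosSemidef := PosSemidef.one.kronecker hBC
  have hsum : ∑ p, (dBC.oneKron A).weight d p = ∑ p, (dB.oneKron A).weight dAB p := by
    have htr : ρ.trace = (margAB ρ).trace := by simpa using hα 1
    rw [← UnitaryDiag.sum_weight (dBC.oneKron A) d,
      ← UnitaryDiag.sum_weight (dB.oneKron A) dAB] at htr
    exact_mod_cast htr
  have hlog1 := (dBC.oneKron A).sum_weight_mul_log_sub d
  have hlog2 := (dB.oneKron A).sum_weight_mul_log_sub dAB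
  rw [UnitaryDiag.oneKron_fn, hβ, UnitaryDiag.trace_mul_fn_log, ← Complex.ofReal_sub,
    Complex.ofReal_inj] at hlog1
  rw [UnitaryDiag.oneKron_fn, hκ, UnitaryDiag.trace_mul_fn_log, ← Complex.ofReal_sub,
    Complex.ofReal_inj] at hlog2
  have hsylv := fun (t : ℝ) (ht : 0 < t) =>
    UnitaryDiag.sylv_mul_eq_of_sum_log_eq (dBC.oneKron A) d (dB.oneKron A) dAB
      (kronOneHom A B C) hX hρ hβα hα (fun p => hdBC p.2) hd (fun p => hdB p.2) hdAB
      (by rw [hβpow]; exact d.map_pow_zero_mul dBC hd _ hβ)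
      (by rw [hκpow]; exact dAB.map_pow_zero_mul dB hdAB _ hκ)
      hsum (by rw [hlog1, hlog2]; linarith) ht
  have hmod := UnitaryDiag.pow_mul_pow_mul_eq (dBC.oneKron A) d (dB.oneKron A) dAB
    (kronOneHom A B C) (fun p => hdBC p.2) hd (fun p => hdB p.2) hdAB hsylv
  simp only [hβpow, hκpow] at hmod
  rw [dAB.eq_supp_pow_zero hPAB, dBC.eq_supp_pow_zero hPBC, d.eq_supp_pow_zero hPABC]
  exact support_mul_support_eq d dAB dBC dB hd hdAB hdBC hdB _ _ _ hα hκ hβα hmod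

end Marginals

lemma posSemidef_of_mul_eq {n : Type*} [Fintype n] [DecidableEq n] {P Q R : Matrix n n ℂ}
    (hP : P.IsHermitian) (hPP : P * P = P) (hQ : Q.IsHermitian) (hQQ : Q * Q = Q)
    (hR : R.IsHermitian) (h : P * Q = R) : ((1 - P) + (1 - Q) - (1 - R)).PosSemidef := by
  have hcomm : Q * P = R := by
    have := congrArg conjTranspose h
    rwa [conjTranspose_mul, hP.eq, hQ.eq, hR.eq] at this
  have hRQ : R * Q = R := by rw [← h, Matrix.mul_assoc, hQQ]
  have hPR : P * R = R := by rw [← h, ← Matrix.mul_assoc, hPP]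
  have key : (1 - P) + (1 - Q) - (1 - R) = ((1 - P) * (1 - Q))ᴴ * ((1 - P) * (1 - Q)) := by
    have h1 : (1 - P) * (1 - Q) = 1 - P - Q + R := by
      rw [← h]; noncomm_ring
    have h2 : (1 - P - Q + R)ᴴ = 1 - P - Q + R := by
      simp only [conjTranspose_add, conjTranspose_sub, conjTranspose_one, hP.eq, hQ.eq, hR.eq]
    have hQR : Q * R = R := by rw [← hcomm, ← Matrix.mul_assoc, hQQ]
    have hRP : R * P = R := by rw [← hcomm, Matrix.mul_assoc, hPP]
    have hRR : R * R = R := by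
      conv_lhs => enter [1]; rw [← h]
      rw [Matrix.mul_assoc, hQR, hPR]
    rw [h1, h2]
    simp only [Matrix.mul_add, Matrix.mul_sub, Matrix.add_mul, Matrix.sub_mul, Matrix.mul_one,
      Matrix.one_mul, h, hcomm, hPP, hQQ, hRQ, hPR, hQR, hRP, hRR]
    abel
  rw [key]
  exact posSemidef_conjTranspose_mul_self _

/-- For a quantum Markov chain `ρ_ABC` (`I(A:C|B) = 0`), the operator
inequality `(1 - P_AB ⊗ 1_C) + (1 - 1_A ⊗ P_BC) ≥ 1 - P_ABC` holds, i.e. the difference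
of the two sides is positive semidefinite. -/
theorem projector_sum_dominates_global_projector
    {A B C : Type*} [Fintype A] [DecidableEq A] [Fintype B] [DecidableEq B]
    [Fintype C] [DecidableEq C]
    (ρ : Matrix (A × B × C) (A × B × C) ℂ) (hρ : IsDensityMatrix ρ)
    (hMarkov : CMI ρ = 0)
    (PAB : Matrix (A × B) (A × B) ℂ) (hPAB : IsSupportProj (margAB ρ) PAB)
    (PBC : Matrix (B × C) (B × C) ℂ) (hPBC : IsSupportProj (margBC ρ) PBC)
    (PABC : Matrix (A × B × C) (A × B × C) ℂ) (hPABC : IsSupportProj ρ PABC) :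
    (((1 - Matrix.reindex (Equiv.prodAssoc A B C) (Equiv.prodAssoc A B C)
          (PAB ⊗ₖ (1 : Matrix C C ℂ)))
        + (1 - (1 : Matrix A A ℂ) ⊗ₖ PBC))
      - (1 - PABC)).PosSemidef := by
  exact posSemidef_of_mul_eq (P := kronOneHom A B C PAB) (Q := oneKronHom A (B × C) PBC)
    ((map_star (kronOneHom A B C) PAB).symm.trans (congrArg _ hPAB.1))
    (by rw [← map_mul, hPAB.2.1])
    ((map_star (oneKronHom A (B × C)) PBC).symm.trans (congrArg _ hPBC.1))
    (by rw [← map_mul, hPBC.2.1]) hPABC.1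
    (support_mul_support_eq_of_CMI_eq_zero hρ.1 hMarkov hPAB hPBC hPABC)
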